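/- (Entropy inequality for the resistive GLM-MHD equations, Theorem 2.2.) Fix γ > 1, μ, η, κ, R > 0, c_h ∈ ℝ, α ≥ 0 and L > 0. Let (ρ, v, p, B, ψ) be twice continuously differentiable on (0, T) × ℝ³, spatially L-periodic in each coordinate direction, with ρ > 0 and p > 0 everywhere, and suppose the conserved variables u = (ρ, ρv, E, B, ψ) satisfy pointwise the resistive GLM-MHD system ∂ₜu + ∇·f^a(u) − ∇·fᵛ(u, ∇u) + φ(∇·B) = r. Then the total entropy is nonincreasing: for every t ∈ (0, T), (d/dt) ∫_{[0,L]³} S(u(t, x)) dx ≤ 0. -/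

import Mathlib

open Matrix MeasureTheory

/-- Partial derivative in coordinate direction `i` (coordinate `0` is time `t`,
coordinates `1,2,3` are space) of a scalar function on ℝ⁴ = ℝ_t × ℝ³. -/
noncomputable def pd (i : Fin 4) (f : (Fin 4 → ℝ) → ℝ) (x : Fin 4 → ℝ) : ℝ :=
  fderiv ℝ f x (Pi.single i 1)

/-- The spatial coordinate index corresponding to the space direction `d`. -/
def sp (d : Fin 3) : Fin 4 := ⟨d.1 + 1, by omega⟩

/-- Spatial partial derivative in direction `d`. -/
noncomputable def spd (d : Fin 3) (f : (Fin 4 → ℝ) → ℝ) (x : Fin 4 → ℝ) : ℝ :=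
  pd (sp d) f x

/-- Spatial `L`-periodicity in each coordinate direction. -/
def SpatiallyPeriodic (L : ℝ) (f : (Fin 4 → ℝ) → ℝ) : Prop :=
  ∀ (x : Fin 4 → ℝ) (d : Fin 3), f (x + L • (Pi.single (sp d) 1 : Fin 4 → ℝ)) = f x

/-- The conserved variables `u = (ρ, ρv, E, B, ψ)` with total energy
`E = p/(γ−1) + ½ρ‖v‖² + ½‖B‖² + ½ψ²`. -/
noncomputable def consVar (γ : ℝ) (ρ p ψ : (Fin 4 → ℝ) → ℝ)
    (v B : Fin 3 → (Fin 4 → ℝ) → ℝ) (x : Fin 4 → ℝ) : Fin 9 → ℝ :=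
  ![ρ x,
    ρ x * v 0 x, ρ x * v 1 x, ρ x * v 2 x,
    p x / (γ - 1) + (1/2) * ρ x * (∑ k, (v k x) ^ 2)
      + (1/2) * (∑ k, (B k x) ^ 2) + (1/2) * (ψ x) ^ 2,
    B 0 x, B 1 x, B 2 x, ψ x]

/-- The advective GLM-MHD flux `f^a_d` in spatial direction `d` with GLM wave
speed `c_h`. -/
noncomputable def fadvP (γ c_h : ℝ) (ρ p ψ : (Fin 4 → ℝ) → ℝ)
    (v B : Fin 3 → (Fin 4 → ℝ) → ℝ) (d : Fin 3) (x : Fin 4 → ℝ) : Fin 9 → ℝ :=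
  ![ρ x * v d x,
    ρ x * v 0 x * v d x + (p x + (1/2) * ∑ k, (B k x) ^ 2)
      * (if (0 : Fin 3) = d then 1 else 0) - B 0 x * B d x,
    ρ x * v 1 x * v d x + (p x + (1/2) * ∑ k, (B k x) ^ 2)
      * (if (1 : Fin 3) = d then 1 else 0) - B 1 x * B d x,
    ρ x * v 2 x * v d x + (p x + (1/2) * ∑ k, (B k x) ^ 2)
      * (if (2 : Fin 3) = d then 1 else 0) - B 2 x * B d x,
    v d x * ((1/2) * ρ x * (∑ k, (v k x) ^ 2) + γ * p x / (γ - 1) + ∑ k, (B k x) ^ 2)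
      - B d x * (∑ k, v k x * B k x) + c_h * ψ x * B d x,
    v d x * B 0 x - B d x * v 0 x + c_h * ψ x * (if d = 0 then 1 else 0),
    v d x * B 1 x - B d x * v 1 x + c_h * ψ x * (if d = 1 then 1 else 0),
    v d x * B 2 x - B d x * v 2 x + c_h * ψ x * (if d = 2 then 1 else 0),
    c_h * B d x]

/-- The viscous flux `fᵛ_d` in spatial direction `d`, with viscous stress tensor
`τ = μ(∇v + (∇v)ᵀ) − (2/3)μ(∇·v)I`, heat flux term `(κ/R)∇(p/ρ)` and resistive
terms scaled by `η`. -/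
noncomputable def fviscP (μ η κ R : ℝ) (ρ p : (Fin 4 → ℝ) → ℝ)
    (v B : Fin 3 → (Fin 4 → ℝ) → ℝ) (d : Fin 3) (x : Fin 4 → ℝ) : Fin 9 → ℝ :=
  let gv : Fin 3 → Fin 3 → ℝ := fun k e => spd e (v k) x
  let gB : Fin 3 → Fin 3 → ℝ := fun k e => spd e (B k) x
  let τ : Fin 3 → Fin 3 → ℝ := fun i j =>
    μ * (gv i j + gv j i) - (2/3) * μ * (∑ k, gv k k) * (if i = j then (1 : ℝ) else 0)
  ![0,
    τ 0 d, τ 1 d, τ 2 d,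
    (∑ i, τ i d * v i x) + (κ / R) * spd d (fun y => p y / ρ y) x
      + η * ∑ k, B k x * (gB k d - gB d k),
    η * (gB 0 d - gB d 0), η * (gB 1 d - gB d 1), η * (gB 2 d - gB d 2),
    0]

/-- The entropy function `S = −ρs/(γ−1)` with `s = log (p ρ^(−γ))`. -/
noncomputable def entSP (γ : ℝ) (ρ p : (Fin 4 → ℝ) → ℝ) (x : Fin 4 → ℝ) : ℝ :=
  -(ρ x * Real.log (p x * (ρ x) ^ (-γ))) / (γ - 1)

theorem sp_eq_succ (d : Fin 3) : sp d = d.succ := rfl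

theorem finCons_add_single (t L : ℝ) (y : Fin 3 → ℝ) (d : Fin 3) :
    (Fin.cons t (y + L • (Pi.single d 1 : Fin 3 → ℝ)) : Fin 4 → ℝ)
      = (Fin.cons t y : Fin 4 → ℝ) + L • (Pi.single (sp d) 1 : Fin 4 → ℝ) := by
  funext i
  refine Fin.cases ?_ (fun j => ?_) i
  · simp [sp_eq_succ, Fin.succ_ne_zero, eq_comm]
  · simp [sp_eq_succ, Pi.single_apply]

theorem hasDerivAt_finCons_left (t : ℝ) (y : Fin 3 → ℝ) :
    HasDerivAt (fun τ : ℝ => (Fin.cons τ y : Fin 4 → ℝ)) (Pi.single 0 1) t := by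
  rw [hasDerivAt_pi]
  intro i
  refine Fin.cases ?_ (fun j => ?_) i
  · exact hasDerivAt_id' t
  · simpa using hasDerivAt_const t (y j)

theorem hasFDerivAt_finCons_right (t : ℝ) (y : Fin 3 → ℝ) :
    HasFDerivAt (fun z : Fin 3 → ℝ => (Fin.cons t z : Fin 4 → ℝ))
      ((0 : (Fin 3 → ℝ) →L[ℝ] ℝ).finCons (ContinuousLinearMap.id ℝ (Fin 3 → ℝ))) y :=
  (hasFDerivAt_const t y).finCons (hasFDerivAt_id y)

theorem continuous_finCons :
    Continuous (fun q : ℝ × (Fin 3 → ℝ) => (Fin.cons q.1 q.2 : Fin 4 → ℝ)) := by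
  fun_prop

section SlabCalculus

variable {U : Set (Fin 4 → ℝ)} {f : (Fin 4 → ℝ) → ℝ}

theorem isOpen_slab (T : ℝ) : IsOpen {x : Fin 4 → ℝ | x 0 ∈ Set.Ioo 0 T} :=
  isOpen_Ioo.preimage (continuous_apply 0)

theorem ContDiffOn.pd_of_isOpen (hf : ContDiffOn ℝ 2 f U) (hU : IsOpen U) (i : Fin 4) :
    ContDiffOn ℝ 1 (pd i f) U :=
  (hf.fderiv_of_isOpen hU (by norm_num)).clm_apply contDiffOn_const

theorem ContDiffOn.continuousOn_pd (hf : ContDiffOn ℝ 1 f U) (hU : IsOpen U) (i : Fin 4) :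
    ContinuousOn (pd i f) U :=
  (hf.continuousOn_fderiv_of_isOpen hU le_rfl).clm_apply continuousOn_const

theorem ContDiffOn.differentiableAt_of_isOpen {n : WithTop ℕ∞} (hf : ContDiffOn ℝ n f U)
    (hn : n ≠ 0) (hU : IsOpen U) {x : Fin 4 → ℝ} (hx : x ∈ U) : DifferentiableAt ℝ f x :=
  (hf.contDiffAt (hU.mem_nhds hx)).differentiableAt hn

theorem SpatiallyPeriodic.pd {L : ℝ} (hf : SpatiallyPeriodic L f) (i : Fin 4) :
    SpatiallyPeriodic L (pd i f) := by
  intro x d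
  have h : (fun y => f (y + L • (Pi.single (sp d) 1 : Fin 4 → ℝ))) = f := funext fun y => hf y d
  unfold _root_.pd
  rw [← fderiv_comp_add_right, h]

/-- Differentiation under the integral sign over the periodic cell. -/
theorem hasDerivAt_integral_cell {L T t : ℝ} {f : (Fin 4 → ℝ) → ℝ}
    (hf : ContDiffOn ℝ 1 f {x | x 0 ∈ Set.Ioo 0 T}) (ht : t ∈ Set.Ioo 0 T) :
    HasDerivAt (fun τ => ∫ y in Set.Icc (0 : Fin 3 → ℝ) (fun _ => L), f (Fin.cons τ y))
      (∫ y in Set.Icc (0 : Fin 3 → ℝ) (fun _ => L), pd 0 f (Fin.cons t y)) t := by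
  set K : Set (Fin 3 → ℝ) := Set.Icc 0 (fun _ => L) with hK
  have hU := isOpen_slab T
  obtain ⟨ε, hε, hεT⟩ := Metric.nhds_basis_closedBall.mem_iff.1 (isOpen_Ioo.mem_nhds ht)
  have hslice : ∀ g : (Fin 4 → ℝ) → ℝ, ContinuousOn g {x | x 0 ∈ Set.Ioo 0 T} →
      ∀ τ ∈ Set.Ioo 0 T, Continuous fun y : Fin 3 → ℝ => g (Fin.cons τ y) := fun g hg τ hτ =>
    hg.comp_continuous (continuous_finCons.comp (Continuous.prodMk_right τ)) fun y => by
      simpa using hτ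
  have hpd := hf.continuousOn_pd hU 0
  have hcomp : IsCompact (Metric.closedBall t ε ×ˢ K) :=
    (isCompact_closedBall t ε).prod isCompact_Icc
  obtain ⟨C, hC⟩ := hcomp.exists_bound_of_continuousOn
    (f := fun q : ℝ × (Fin 3 → ℝ) => pd 0 f (Fin.cons q.1 q.2))
    (hpd.comp continuous_finCons.continuousOn fun q hq => by simpa using hεT hq.1)
  refine (hasDerivAt_integral_of_dominated_loc_of_deriv_le (bound := fun _ => C)
    (F' := fun τ y => pd 0 f (Fin.cons τ y)) (Metric.closedBall_mem_nhds t hε) ?_ ?_ ?_ ?_ ?_ ?_).2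
  · filter_upwards [isOpen_Ioo.mem_nhds ht] with τ hτ
    exact (hslice f hf.continuousOn τ hτ).aestronglyMeasurable
  · exact (hslice f hf.continuousOn t ht).continuousOn.integrableOn_Icc
  · exact (hslice _ hpd t ht).aestronglyMeasurable
  · filter_upwards [ae_restrict_mem measurableSet_Icc] with y hy τ hτ
    exact hC (τ, y) ⟨hτ, hy⟩
  · exact continuousOn_const.integrableOn_Icc
  · refine Filter.Eventually.of_forall fun y τ hτ => ?_
    have hmem : (Fin.cons τ y : Fin 4 → ℝ) ∈ {x : Fin 4 → ℝ | x 0 ∈ Set.Ioo 0 T} := by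
      simpa using hεT hτ
    exact (hf.differentiableAt_of_isOpen one_ne_zero hU hmem).hasFDerivAt.comp_hasDerivAt τ
      (hasDerivAt_finCons_left τ y)

/-- The divergence of a spatially periodic `C¹` field integrates to zero over the periodic cell. -/
theorem integral_divergence_cell_eq_zero {L T t : ℝ} (hL : 0 < L)
    {G : Fin 3 → (Fin 4 → ℝ) → ℝ}
    (hG : ∀ d, ContDiffOn ℝ 1 (G d) {x | x 0 ∈ Set.Ioo 0 T})
    (hper : ∀ d, SpatiallyPeriodic L (G d)) (ht : t ∈ Set.Ioo 0 T) :
    ∫ y in Set.Icc (0 : Fin 3 → ℝ) (fun _ => L), ∑ d, spd d (G d) (Fin.cons t y) = 0 := by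
  have hU := isOpen_slab T
  have hmem : ∀ y, (Fin.cons t y : Fin 4 → ℝ) ∈ {x : Fin 4 → ℝ | x 0 ∈ Set.Ioo 0 T} :=
    fun y => by simpa using ht
  have hcons := continuous_finCons.comp (Continuous.prodMk_right t)
  let ι : (Fin 3 → ℝ) →L[ℝ] (Fin 4 → ℝ) :=
    (0 : (Fin 3 → ℝ) →L[ℝ] ℝ).finCons (ContinuousLinearMap.id ℝ (Fin 3 → ℝ))
  have hι : ∀ d : Fin 3, ι (Pi.single d 1) = (Pi.single (sp d) 1 : Fin 4 → ℝ) := by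
    intro d
    funext i
    refine Fin.cases ?_ (fun j => ?_) i
    · simp [ι, sp_eq_succ, Fin.succ_ne_zero, eq_comm]
    · simp [ι, sp_eq_succ, Pi.single_apply]
  have hdiv := integral_divergence_of_hasFDerivAt_off_countable' (0 : Fin 3 → ℝ) (fun _ => L)
    (fun _ => hL.le) (fun d y => G d (Fin.cons t y))
    (fun d y => (fderiv ℝ (G d) (Fin.cons t y)).comp ι) ∅ Set.countable_empty
    (fun d => ((hG d).continuousOn.comp_continuous hcons hmem).continuousOn)
    (fun y _ d => ((hG d).differentiableAt_of_isOpen one_ne_zero hU (hmem y)).hasFDerivAt.comp y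
      (hasFDerivAt_finCons_right t y))
    (by
      simp only [ContinuousLinearMap.comp_apply, hι]
      exact (continuous_finsetSum _ fun d _ =>
        ((hG d).continuousOn_pd hU (sp d)).comp_continuous hcons hmem).continuousOn.integrableOn_Icc)
  simp only [ContinuousLinearMap.comp_apply, hι] at hdiv
  refine hdiv.trans (Finset.sum_eq_zero fun d _ => sub_eq_zero.2 ?_)
  refine integral_congr_ae (Filter.Eventually.of_forall fun z => ?_)
  have hface : (d.insertNth L z : Fin 3 → ℝ)
      = (d.insertNth 0 z : Fin 3 → ℝ) + L • (Pi.single d 1 : Fin 3 → ℝ) := by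
    funext i
    refine Fin.succAboveCases d ?_ (fun j => ?_) i
    · simp
    · simp
  simp only [Pi.zero_apply, hface]
  exact (congrArg (G d) (finCons_add_single t L _ d)).trans (hper d _ d)

end SlabCalculus

section PartialDerivatives

variable {i : Fin 4} {x : Fin 4 → ℝ} {f g : (Fin 4 → ℝ) → ℝ}

theorem pd_const (c : ℝ) : pd i (fun _ => c) x = 0 := by
  simp [pd]

theorem pd_add (hf : DifferentiableAt ℝ f x) (hg : DifferentiableAt ℝ g x) :
    pd i (fun y => f y + g y) x = pd i f x + pd i g x := by
  simp [pd, fderiv_fun_add hf hg]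

theorem pd_sub (hf : DifferentiableAt ℝ f x) (hg : DifferentiableAt ℝ g x) :
    pd i (fun y => f y - g y) x = pd i f x - pd i g x := by
  simp [pd, fderiv_fun_sub hf hg]

theorem pd_mul (hf : DifferentiableAt ℝ f x) (hg : DifferentiableAt ℝ g x) :
    pd i (fun y => f y * g y) x = f x * pd i g x + g x * pd i f x := by
  simp [pd, fderiv_fun_mul hf hg]

theorem pd_div (hf : DifferentiableAt ℝ f x) (hg : DifferentiableAt ℝ g x) (h0 : g x ≠ 0) :
    pd i (fun y => f y / g y) x = (pd i f x * g x - f x * pd i g x) / g x ^ 2 := by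
  have h := (hf.hasFDerivAt.mul ((hasDerivAt_inv h0).comp_hasFDerivAt x hg.hasFDerivAt)).fderiv
  simp only [pd, div_eq_mul_inv]
  erw [h]
  simp
  field_simp
  ring

theorem pd_div_const (hf : DifferentiableAt ℝ f x) (c : ℝ) :
    pd i (fun y => f y / c) x = pd i f x / c := by
  simp only [div_eq_mul_inv]
  rw [pd_mul hf (differentiableAt_const _), pd_const]
  ring

theorem pd_log (hf : DifferentiableAt ℝ f x) (h0 : f x ≠ 0) :
    pd i (fun y => Real.log (f y)) x = pd i f x / f x := by
  simp [pd, fderiv.log hf h0, div_eq_inv_mul]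

end PartialDerivatives

/-- Balance law for the internal energy: subtracting the kinetic, magnetic and GLM contributions
from the total energy equation leaves only viscous, conductive, resistive and damping work. -/
theorem internal_energy_balance {γ c_h α : ℝ} {ρ p ψ : (Fin 4 → ℝ) → ℝ}
    {v B : Fin 3 → (Fin 4 → ℝ) → ℝ} {q : Fin 3 → (Fin 4 → ℝ) → ℝ}
    {τ J : Fin 3 → Fin 3 → (Fin 4 → ℝ) → ℝ} {F : Fin 3 → (Fin 4 → ℝ) → Fin 9 → ℝ}
    {x : Fin 4 → ℝ}
    (hρ : DifferentiableAt ℝ ρ x) (hp : DifferentiableAt ℝ p x) (hψ : DifferentiableAt ℝ ψ x)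
    (hv : ∀ k, DifferentiableAt ℝ (v k) x) (hB : ∀ k, DifferentiableAt ℝ (B k) x)
    (hq : ∀ d, DifferentiableAt ℝ (q d) x)
    (hτ : ∀ k d, DifferentiableAt ℝ (τ k d) x) (hJ : ∀ k d, DifferentiableAt ℝ (J k d) x)
    (hF : ∀ d y, F d y = ![0, τ 0 d y, τ 1 d y, τ 2 d y,
      (∑ i, τ i d y * v i y) + q d y + ∑ k, B k y * J k d y, J 0 d y, J 1 d y, J 2 d y, 0])
    (hPDE : ∀ a : Fin 9,
      pd 0 (fun y => consVar γ ρ p ψ v B y a) x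
        + (∑ d, spd d (fun y => fadvP γ c_h ρ p ψ v B d y a) x)
        - (∑ d, spd d (fun y => F d y a) x)
        + (![0, 0, 0, 0, 0, v 0 x, v 1 x, v 2 x, 0] : Fin 9 → ℝ) a
            * (∑ d, spd d (B d) x)
      = (![0, 0, 0, 0, 0, 0, 0, 0, -(α * ψ x)] : Fin 9 → ℝ) a) :
    pd 0 p x / (γ - 1)
      + (∑ d, (γ * p x / (γ - 1) * spd d (v d) x + (γ / (γ - 1) - 1) * (v d x * spd d p x)))
      = (∑ d, ((∑ i, τ i d x * spd d (v i) x) + spd d (q d) x + ∑ k, J k d x * spd d (B k) x))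
        + α * ψ x ^ 2 := by
  have hv0 := hv 0
  have hv1 := hv 1
  have hv2 := hv 2
  have hB0 := hB 0
  have hB1 := hB 1
  have hB2 := hB 2
  have mass := hPDE 0
  have mom0 := hPDE 1
  have mom1 := hPDE 2
  have mom2 := hPDE 3
  have energy := hPDE 4
  have ind0 := hPDE 5
  have ind1 := hPDE 6
  have ind2 := hPDE 7
  have glm := hPDE 8
  clear hPDE
  simp [hF, consVar, fadvP, spd, Fin.sum_univ_three, sq]
    at mass mom0 mom1 mom2 energy ind0 ind1 ind2 glm
  simp (disch := fun_prop) only [pd_add, pd_sub, pd_mul, pd_div_const, pd_const]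
    at mass mom0 mom1 mom2 energy ind0 ind1 ind2 glm
  simp only [spd, Fin.sum_univ_three]
  linear_combination energy - v 0 x * mom0 - v 1 x * mom1 - v 2 x * mom2
    - B 0 x * ind0 - B 1 x * ind1 - B 2 x * ind2 - ψ x * glm
    + (1/2) * (v 0 x ^ 2 + v 1 x ^ 2 + v 2 x ^ 2) * mass

theorem entSP_eq {γ : ℝ} {ρ p : (Fin 4 → ℝ) → ℝ} (hpos : ∀ x, 0 < ρ x ∧ 0 < p x) :
    entSP γ ρ p
      = fun x => (ρ x * (γ * Real.log (ρ x) - Real.log (p x))) / (γ - 1) := by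
  funext x
  obtain ⟨hρ, hp⟩ := hpos x
  rw [entSP, Real.log_mul hp.ne' (Real.rpow_pos_of_pos hρ _).ne', Real.log_rpow hρ]
  ring

theorem pd_entSP {γ : ℝ} {ρ p : (Fin 4 → ℝ) → ℝ} (hpos : ∀ x, 0 < ρ x ∧ 0 < p x)
    {x : Fin 4 → ℝ} (hρ : DifferentiableAt ℝ ρ x) (hp : DifferentiableAt ℝ p x) (i : Fin 4) :
    pd i (entSP γ ρ p) x
      = (pd i ρ x * (γ * Real.log (ρ x) - Real.log (p x))
          + ρ x * (γ * (pd i ρ x / ρ x) - pd i p x / p x)) / (γ - 1) := by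
  have hρ0 := (hpos x).1.ne'
  have hp0 := (hpos x).2.ne'
  have hlρ : DifferentiableAt ℝ (fun y => Real.log (ρ y)) x := hρ.log hρ0
  have hlp : DifferentiableAt ℝ (fun y => Real.log (p y)) x := hp.log hp0
  rw [entSP_eq hpos]
  simp (disch := first | assumption | fun_prop) only
    [pd_sub, pd_mul, pd_div_const, pd_const, pd_log]
  ring

/-- The density of viscous dissipation `τ : ∇v` is nonnegative. -/
theorem viscous_dissipation_nonneg {μ : ℝ} (hμ : 0 ≤ μ) (g : Fin 3 → Fin 3 → ℝ) :
    0 ≤ ∑ d, ∑ i, (μ * (g i d + g d i)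
      - (2/3) * μ * (∑ k, g k k) * (if i = d then (1 : ℝ) else 0)) * g i d := by
  have h : ∑ d, ∑ i, (μ * (g i d + g d i)
      - (2/3) * μ * (∑ k, g k k) * (if i = d then (1 : ℝ) else 0)) * g i d
      = μ * ((g 0 1 + g 1 0) ^ 2 + (g 0 2 + g 2 0) ^ 2 + (g 1 2 + g 2 1) ^ 2
        + (2/3) * ((g 0 0 - g 1 1) ^ 2 + (g 1 1 - g 2 2) ^ 2 + (g 2 2 - g 0 0) ^ 2)) := by
    simp [Fin.sum_univ_three]
    ring
  rw [h]
  positivity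

/-- The density of resistive dissipation, `η ‖∇ × B‖²`, is nonnegative. -/
theorem resistive_dissipation_nonneg {η : ℝ} (hη : 0 ≤ η) (g : Fin 3 → Fin 3 → ℝ) :
    0 ≤ ∑ d, ∑ k, η * (g k d - g d k) * g k d := by
  have h : ∑ d, ∑ k, η * (g k d - g d k) * g k d
      = η * ((g 0 1 - g 1 0) ^ 2 + (g 0 2 - g 2 0) ^ 2 + (g 1 2 - g 2 1) ^ 2) := by
    simp [Fin.sum_univ_three]
    ring
  rw [h]
  positivity

/-- The entropy flux: transport of entropy plus heat flux divided by temperature. -/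
noncomputable def entropyFlux (γ κ R : ℝ) (ρ p : (Fin 4 → ℝ) → ℝ) (v : Fin 3 → (Fin 4 → ℝ) → ℝ)
    (d : Fin 3) (x : Fin 4 → ℝ) : ℝ :=
  v d x * entSP γ ρ p x + (κ / R) * spd d (fun y => p y / ρ y) x * (ρ x / p x)

/-- Divergence of the entropy flux in one direction, with the conductive production isolated. -/
theorem spd_entropyFlux {γ κ R : ℝ} {ρ p : (Fin 4 → ℝ) → ℝ}
    {v : Fin 3 → (Fin 4 → ℝ) → ℝ} (hpos : ∀ x, 0 < ρ x ∧ 0 < p x) {x : Fin 4 → ℝ}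
    (hρ : DifferentiableAt ℝ ρ x) (hp : DifferentiableAt ℝ p x)
    (hS : DifferentiableAt ℝ (entSP γ ρ p) x) (d : Fin 3) (hv : DifferentiableAt ℝ (v d) x)
    (hq : DifferentiableAt ℝ (fun z => (κ / R) * spd d (fun y => p y / ρ y) z) x) :
    spd d (entropyFlux γ κ R ρ p v d) x
      = spd d (v d) x * entSP γ ρ p x + v d x * pd (sp d) (entSP γ ρ p) x
        + ρ x / p x * spd d (fun z => (κ / R) * spd d (fun y => p y / ρ y) z) x
        - (κ / R) * (ρ x / p x * spd d (fun y => p y / ρ y) x) ^ 2 := by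
  have hρ0 := (hpos x).1.ne'
  have hp0 := (hpos x).2.ne'
  have hθ : DifferentiableAt ℝ (fun y => ρ y / p y) x := by fun_prop (disch := assumption)
  have hθ' : spd d (fun y => p y / ρ y) x
      = (spd d p x * ρ x - p x * spd d ρ x) / ρ x ^ 2 := pd_div hp hρ hρ0
  have hflux : spd d (entropyFlux γ κ R ρ p v d) x
      = pd (sp d) (fun y => v d y * entSP γ ρ p y
        + (fun z => (κ / R) * spd d (fun y => p y / ρ y) z) y * (fun y => ρ y / p y) y) x := rfl
  rw [hflux, pd_add (hv.fun_mul hS) (hq.fun_mul hθ), pd_mul hv hS, pd_mul hq hθ, pd_div hρ hp hp0]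
  linear_combination (norm := skip)
    (κ / R) * (ρ x / p x) ^ 2 * spd d (fun y => p y / ρ y) x * hθ'
  simp only [spd]
  field_simp
  ring

/-- Pointwise entropy inequality. -/
theorem entropy_production_nonpos {γ μ η κ R c_h α : ℝ}
    (hγ : 1 < γ) (hμ : 0 < μ) (hη : 0 < η) (hκ : 0 < κ) (hR : 0 < R) (hα : 0 ≤ α)
    {ρ p ψ : (Fin 4 → ℝ) → ℝ} {v B : Fin 3 → (Fin 4 → ℝ) → ℝ} {U : Set (Fin 4 → ℝ)}
    (hU : IsOpen U) (hρ : ContDiffOn ℝ 2 ρ U) (hp : ContDiffOn ℝ 2 p U)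
    (hψ : ContDiffOn ℝ 2 ψ U) (hv : ∀ k, ContDiffOn ℝ 2 (v k) U)
    (hB : ∀ k, ContDiffOn ℝ 2 (B k) U) (hS : ContDiffOn ℝ 2 (entSP γ ρ p) U)
    (hθ : ContDiffOn ℝ 2 (fun y => p y / ρ y) U)
    (hpos : ∀ x, 0 < ρ x ∧ 0 < p x) {x : Fin 4 → ℝ} (hx : x ∈ U)
    (hPDE : ∀ a : Fin 9,
      pd 0 (fun y => consVar γ ρ p ψ v B y a) x
        + (∑ d, spd d (fun y => fadvP γ c_h ρ p ψ v B d y a) x)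
        - (∑ d, spd d (fun y => fviscP μ η κ R ρ p v B d y a) x)
        + (![0, 0, 0, 0, 0, v 0 x, v 1 x, v 2 x, 0] : Fin 9 → ℝ) a
            * (∑ d, spd d (B d) x)
      = (![0, 0, 0, 0, 0, 0, 0, 0, -(α * ψ x)] : Fin 9 → ℝ) a) :
    pd 0 (entSP γ ρ p) x + ∑ d, spd d (entropyFlux γ κ R ρ p v d) x ≤ 0 := by
  have hdiff : ∀ {f : (Fin 4 → ℝ) → ℝ}, ContDiffOn ℝ 2 f U → DifferentiableAt ℝ f x :=
    fun hf => hf.differentiableAt_of_isOpen two_ne_zero hU hx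
  have hdiff' : ∀ {f : (Fin 4 → ℝ) → ℝ} (d : Fin 3), ContDiffOn ℝ 2 f U →
      DifferentiableAt ℝ (spd d f) x :=
    fun d hf => (hf.pd_of_isOpen hU (sp d)).differentiableAt_of_isOpen one_ne_zero hU hx
  have hρx := hdiff hρ
  have hpx := hdiff hp
  have hq : ∀ d, DifferentiableAt ℝ (fun z => (κ / R) * spd d (fun y => p y / ρ y) z) x :=
    fun d => (hdiff' d hθ).const_mul _
  have hgv := fun k d => hdiff' d (hv k)
  have hgB := fun k d => hdiff' d (hB k)
  have hmass := hPDE 0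
  have henergy := internal_energy_balance (q := fun d z => (κ / R) * spd d (fun y => p y / ρ y) z)
    (τ := fun i j z => μ * (spd j (v i) z + spd i (v j) z)
      - (2/3) * μ * (∑ k, spd k (v k) z) * (if i = j then (1 : ℝ) else 0))
    (J := fun k d z => η * (spd d (B k) z - spd k (B d) z))
    (F := fviscP μ η κ R ρ p v B)
    hρx hpx (hdiff hψ) (fun k => hdiff (hv k)) (fun k => hdiff (hB k)) hq
    (fun k d => (((hgv k d).add (hgv d k)).const_mul _).sub
      (((DifferentiableAt.fun_sum fun k _ => hgv k k).const_mul _).mul_const _))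
    (fun k d => ((hgB k d).sub (hgB d k)).const_mul _)
    (fun d y => by
      simp only [fviscP, Finset.mul_sum]
      congr! 6
      ring_nf)
    hPDE
  have hvisc := viscous_dissipation_nonneg hμ.le fun k e => spd e (v k) x
  have hres := resistive_dissipation_nonneg hη.le fun k e => spd e (B k) x
  simp only [Finset.sum_add_distrib] at henergy
  obtain ⟨hρ0, hp0⟩ := hpos x
  have hcond : 0 ≤ ∑ d, (κ / R) * (ρ x / p x * spd d (fun y => p y / ρ y) x) ^ 2 :=
    Finset.sum_nonneg fun d _ => by positivity
  have hmass' : pd 0 ρ x + ∑ d, (ρ x * spd d (v d) x + v d x * spd d ρ x) = 0 := by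
    have hpd : ∀ d, spd d (fun y => ρ y * v d y) x = ρ x * spd d (v d) x + v d x * spd d ρ x :=
      fun d => pd_mul hρx (hdiff (hv d))
    simp only [consVar, fadvP, fviscP, Matrix.cons_val_zero, hpd] at hmass
    simpa [spd, pd_const] using hmass
  have hγ1 : γ - 1 ≠ 0 := (sub_pos.2 hγ).ne'
  simp only [pd_entSP hpos hρx hpx, fun d => spd_entropyFlux hpos hρx hpx (hdiff hS) d
    (hdiff (hv d)) (hq d), Finset.sum_sub_distrib]
  simp only [entSP_eq hpos]
  set V := ∑ d, ∑ i, (μ * (spd d (v i) x + spd i (v d) x)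
    - (2/3) * μ * (∑ k, spd k (v k) x) * (if i = d then (1 : ℝ) else 0)) * spd d (v i) x
  set W := ∑ d, ∑ k, η * (spd d (B k) x - spd k (B d) x) * spd d (B k) x
  have hwork : 0 ≤ ρ x / p x * (V + W + α * ψ x ^ 2) := by positivity
  refine le_of_eq_of_le ?_ (sub_nonpos.2 ((neg_nonpos.2 hwork).trans hcond))
  simp only [spd, Fin.sum_univ_three] at henergy hmass' ⊢
  linear_combination (norm := skip)
    (γ * Real.log (ρ x) - Real.log (p x) + γ) / (γ - 1) * hmass' - ρ x / p x * henergy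
  field_simp
  ring

theorem SpatiallyPeriodic.entropyFlux {γ κ R L : ℝ} {ρ p : (Fin 4 → ℝ) → ℝ}
    {v : Fin 3 → (Fin 4 → ℝ) → ℝ} (hρ : SpatiallyPeriodic L ρ) (hp : SpatiallyPeriodic L p)
    (hv : ∀ k, SpatiallyPeriodic L (v k)) (d : Fin 3) :
    SpatiallyPeriodic L (entropyFlux γ κ R ρ p v d) := by
  intro x e
  have hθ : SpatiallyPeriodic L (fun y => p y / ρ y) := fun y e =>
    congrArg₂ (· / ·) (hp y e) (hρ y e)
  have hq : SpatiallyPeriodic L (spd d fun y => p y / ρ y) := hθ.pd (sp d)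
  simp only [_root_.entropyFlux, entSP, hρ x e, hp x e, hv d x e, hq x e]

/-- **Entropy inequality for the resistive GLM-MHD equations** (Theorem 2.2).
For a spatially `L`-periodic C² solution of the resistive GLM-MHD system on
`(0,T) × ℝ³` with positive density and pressure, the total entropy
`∫_{[0,L]³} S dx` is nonincreasing in time. -/
theorem resistive_glm_mhd_total_entropy_nonincreasing
    (γ μ η κ R c_h α L T : ℝ)
    (hγ : 1 < γ) (hμ : 0 < μ) (hη : 0 < η) (hκ : 0 < κ) (hR : 0 < R)
    (hα : 0 ≤ α) (hL : 0 < L) (hT : 0 < T)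
    (ρ p ψ : (Fin 4 → ℝ) → ℝ) (v B : Fin 3 → (Fin 4 → ℝ) → ℝ)
    (hρreg : ContDiffOn ℝ 2 ρ {x | x 0 ∈ Set.Ioo 0 T})
    (hpreg : ContDiffOn ℝ 2 p {x | x 0 ∈ Set.Ioo 0 T})
    (hψreg : ContDiffOn ℝ 2 ψ {x | x 0 ∈ Set.Ioo 0 T})
    (hvreg : ∀ k, ContDiffOn ℝ 2 (v k) {x | x 0 ∈ Set.Ioo 0 T})
    (hBreg : ∀ k, ContDiffOn ℝ 2 (B k) {x | x 0 ∈ Set.Ioo 0 T})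
    (hρper : SpatiallyPeriodic L ρ) (hpper : SpatiallyPeriodic L p)
    (hψper : SpatiallyPeriodic L ψ)
    (hvper : ∀ k, SpatiallyPeriodic L (v k))
    (hBper : ∀ k, SpatiallyPeriodic L (B k))
    (hpos : ∀ x : Fin 4 → ℝ, 0 < ρ x ∧ 0 < p x)
    (hPDE : ∀ x ∈ {x : Fin 4 → ℝ | x 0 ∈ Set.Ioo 0 T}, ∀ a : Fin 9,
      pd 0 (fun y => consVar γ ρ p ψ v B y a) x
        + (∑ d, spd d (fun y => fadvP γ c_h ρ p ψ v B d y a) x)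
        - (∑ d, spd d (fun y => fviscP μ η κ R ρ p v B d y a) x)
        + (![0, 0, 0, 0, 0, v 0 x, v 1 x, v 2 x, 0] : Fin 9 → ℝ) a
            * (∑ d, spd d (B d) x)
      = (![0, 0, 0, 0, 0, 0, 0, 0, -(α * ψ x)] : Fin 9 → ℝ) a) :
    ∀ t ∈ Set.Ioo (0 : ℝ) T,
      deriv (fun τ => ∫ y in Set.Icc (0 : Fin 3 → ℝ) (fun _ => L),
        entSP γ ρ p (Fin.cons τ y)) t ≤ 0 := by
  intro t ht
  have hU := isOpen_slab T
  have hρ0 : ∀ x, ρ x ≠ 0 := fun x => (hpos x).1.ne'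
  have hp0 : ∀ x, p x ≠ 0 := fun x => (hpos x).2.ne'
  have hS : ContDiffOn ℝ 2 (entSP γ ρ p) {x | x 0 ∈ Set.Ioo 0 T} := by
    rw [entSP_eq hpos]
    exact (hρreg.mul ((contDiffOn_const.mul (hρreg.log fun x _ => hρ0 x)).sub
      (hpreg.log fun x _ => hp0 x))).div_const _
  have hθ : ContDiffOn ℝ 2 (fun y => p y / ρ y) {x | x 0 ∈ Set.Ioo 0 T} :=
    hpreg.div hρreg fun x _ => hρ0 x
  have hG : ∀ d, ContDiffOn ℝ 1 (entropyFlux γ κ R ρ p v d) {x | x 0 ∈ Set.Ioo 0 T} := fun d =>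
    (((hvreg d).mul hS).of_le one_le_two).add ((contDiffOn_const.mul (hθ.pd_of_isOpen hU (sp d))).mul
      ((hρreg.div hpreg fun x _ => hp0 x).of_le one_le_two))
  have hcont : ∀ {f : (Fin 4 → ℝ) → ℝ} (i : Fin 4), ContDiffOn ℝ 1 f {x | x 0 ∈ Set.Ioo 0 T} →
      Continuous fun y : Fin 3 → ℝ => pd i f (Fin.cons t y) := fun i hf =>
    (hf.continuousOn_pd hU i).comp_continuous
      (continuous_finCons.comp (Continuous.prodMk_right t)) fun y => by simpa using ht
  have hS1 := hS.of_le one_le_two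
  have hdiv := integral_divergence_cell_eq_zero hL hG
    (fun d => SpatiallyPeriodic.entropyFlux hρper hpper hvper d) ht
  refine (hasDerivAt_integral_cell hS1 ht).deriv.trans_le ?_
  have hdivc : Continuous fun y : Fin 3 → ℝ =>
      ∑ d, spd d (entropyFlux γ κ R ρ p v d) (Fin.cons t y) :=
    continuous_finsetSum _ fun d _ => hcont (sp d) (hG d)
  refine ((add_zero _).symm.trans (congrArg _ hdiv.symm)).trans_le ?_
  rw [← integral_add
    (hcont 0 hS1).continuousOn.integrableOn_Icc hdivc.continuousOn.integrableOn_Icc]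
  refine integral_nonpos fun y => ?_
  have hy : (Fin.cons t y : Fin 4 → ℝ) ∈ {x : Fin 4 → ℝ | x 0 ∈ Set.Ioo 0 T} := by simpa using ht
  exact entropy_production_nonpos hγ hμ hη hκ hR hα hU hρreg hpreg hψreg hvreg hBreg hS hθ hpos hy
    (hPDE _ hy)
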